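/- arXiv:math/0607329 — 2 statements merged into one kernel-verified Lean document; each statement's English description precedes it below -/
import Mathlib

section
/- Let G be a perfect unmixed finite simple graph on vertices x_1,…,x_n with no isolated vertices, and let v_1,…,v_q ∈ {0,1}^n be the incidence vectors of the maximal independent sets of G. Then the monomial subring K[x^{v_1}t,…,x^{v_q}t] ⊂ K[x_1,…,x_n,t] is normal; equivalently, every vector of ℤ^{n+1} lying in the cone of non-negative real combinations of (v_1,1),…,(v_q,1) and in the subgroup of ℤ^{n+1} generated by (v_1,1),…,(v_q,1) is a non-negative integer combination of (v_1,1),…,(v_q,1). -/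
open Finset

/-- A vertex cover of a graph: a set of vertices meeting every edge. -/
def IsVCover {n : ℕ} (G : SimpleGraph (Fin n)) (C : Finset (Fin n)) : Prop :=
  ∀ ⦃a b : Fin n⦄, G.Adj a b → a ∈ C ∨ b ∈ C

/-- A minimal vertex cover: no proper subset is a vertex cover. -/
def IsMinVCover {n : ℕ} (G : SimpleGraph (Fin n)) (C : Finset (Fin n)) : Prop :=
  IsVCover G C ∧ ∀ D : Finset (Fin n), D ⊂ C → ¬ IsVCover G D

/-- The clique number of a graph: maximal size of a clique. -/
noncomputable def cliqueNumber {V : Type*} (G : SimpleGraph V) : ℕ :=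
  sSup { k : ℕ | ∃ t : Finset V, G.IsNClique k t }

/-- A graph is perfect if for every induced subgraph the chromatic number
equals the clique number. -/
def IsPerfect {V : Type*} (G : SimpleGraph V) : Prop :=
  ∀ s : Set V, (G.induce s).chromaticNumber = (cliqueNumber (G.induce s) : ℕ∞)

/-- The Rees cone of the ideal of vertex covers `I_c(G)`: all non-negative real
combinations of the unit vectors `e_1,…,e_n` and the vectors `(u_C, 1)` where
`u_C` runs over incidence vectors of minimal vertex covers of `G`. Vectors of
`ℝ^{n+1}` are represented as pairs `(a, a_{n+1}) : (Fin n → ℝ) × ℝ`. -/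
def reesCone {n : ℕ} (G : SimpleGraph (Fin n)) : Set ((Fin n → ℝ) × ℝ) :=
  { v | ∃ (c : Fin n → ℝ) (d : Finset (Fin n) → ℝ),
      (∀ i, 0 ≤ c i) ∧ (∀ C, 0 ≤ d C) ∧
      (∀ C, d C ≠ 0 → IsMinVCover G C) ∧
      (∀ i, v.1 i = c i + ∑ C : Finset (Fin n), d C * (if i ∈ C then 1 else 0)) ∧
      v.2 = ∑ C : Finset (Fin n), d C }


/-- An independent set of `G`: no two of its vertices are adjacent. -/
def IsIndepSet {n : ℕ} (G : SimpleGraph (Fin n)) (S : Finset (Fin n)) : Prop :=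
  ∀ ⦃a⦄, a ∈ S → ∀ ⦃b⦄, b ∈ S → ¬ G.Adj a b

/-- A maximal independent set: an independent set not properly contained in
another independent set. -/
def IsMaxIndepSet {n : ℕ} (G : SimpleGraph (Fin n)) (S : Finset (Fin n)) : Prop :=
  IsIndepSet G S ∧ ∀ T : Finset (Fin n), IsIndepSet G T → S ⊆ T → S = T

/-- `G` is unmixed: all minimal vertex covers have the same cardinality. -/
def Unmixed {n : ℕ} (G : SimpleGraph (Fin n)) : Prop :=
  ∀ C D : Finset (Fin n), IsMinVCover G C → IsMinVCover G D → C.card = D.card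

section

variable {n : ℕ} {G : SimpleGraph (Fin n)}

theorem IsIndepSet.mono {S T : Finset (Fin n)} (hT : IsIndepSet G T) (h : S ⊆ T) :
    IsIndepSet G S :=
  fun _ ha _ hb => hT (h ha) (h hb)

/-- An independent set and a clique share at most one vertex. -/
theorem IsIndepSet.card_inter_clique_le_one {S Q : Finset (Fin n)} (hS : IsIndepSet G S)
    (hQ : G.IsClique (Q : Set (Fin n))) : (Q ∩ S).card ≤ 1 := by
  rw [Finset.card_le_one]
  intro x hx y hy
  rw [Finset.mem_inter] at hx hy
  by_contra hne
  exact hS hx.2 hy.2 (hQ (Finset.mem_coe.2 hx.1) (Finset.mem_coe.2 hy.1) hne)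

theorem IsIndepSet.exists_maxIndepSet_superset {S : Finset (Fin n)} (hS : IsIndepSet G S) :
    ∃ T, IsMaxIndepSet G T ∧ S ⊆ T := by
  obtain ⟨T, hST, hT⟩ := (Set.toFinite {T | IsIndepSet G T}).exists_le_maximal hS
  exact ⟨T, ⟨hT.1, fun U hU hTU => le_antisymm hTU (hT.2 hU hTU)⟩, hST⟩

theorem isIndepSet_compl_iff {C : Finset (Fin n)} : IsIndepSet G Cᶜ ↔ IsVCover G C := by
  simp only [IsIndepSet, IsVCover, Finset.mem_compl]
  constructor
  · intro h a b hab
    by_contra! hc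
    exact h hc.1 hc.2 hab
  · intro h a ha b hb hab
    exact (h hab).elim ha hb

theorem IsMaxIndepSet.isMinVCover_compl {S : Finset (Fin n)} (hS : IsMaxIndepSet G S) :
    IsMinVCover G Sᶜ := by
  refine ⟨isIndepSet_compl_iff.1 (by simpa using hS.1), fun D hD hc => ?_⟩
  have hSD : S ⊆ Dᶜ := by
    simpa using Finset.compl_subset_compl.2 hD.1
  have hEq := hS.2 Dᶜ (isIndepSet_compl_iff.2 hc) hSD
  rw [hEq, compl_compl] at hD
  exact hD.2 subset_rfl

theorem Unmixed.card_eq (hunm : Unmixed G) {S T : Finset (Fin n)} (hS : IsMaxIndepSet G S)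
    (hT : IsMaxIndepSet G T) : S.card = T.card := by
  have h := hunm _ _ hS.isMinVCover_compl hT.isMinVCover_compl
  have h₁ := Finset.card_add_card_compl S
  have h₂ := Finset.card_add_card_compl T
  omega

/-- Double counting: the total weight on `Q` of a combination of incidence vectors. -/
theorem sum_incidence_eq {R : Type*} [CommSemiring R] (c : Finset (Fin n) → R)
    (Q : Finset (Fin n)) :
    ∑ i ∈ Q, ∑ S, c S * (if i ∈ S then 1 else 0) = ∑ S, c S * ((Q ∩ S).card : R) := by
  rw [Finset.sum_comm]
  refine Finset.sum_congr rfl fun S _ => ?_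
  rw [← Finset.mul_sum, Finset.sum_boole, Finset.filter_mem_eq_inter]

theorem cliqueNumber_le {V : Type*} {H : SimpleGraph V} {b : ℕ}
    (h : ∀ t : Finset V, H.IsClique (t : Set V) → t.card ≤ b) : cliqueNumber H ≤ b := by
  refine csSup_le' ?_
  rintro k ⟨t, ht⟩
  exact ht.card_eq ▸ h t ht.isClique

/-- The `0/1`-weighted case of `IsPerfect.exists_indep_decomposition`. -/
theorem IsPerfect.exists_indep_decomposition_of_le_one (hperf : IsPerfect G) {a : Fin n → ℕ}
    (ha : ∀ i, a i ≤ 1) {b : ℕ}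
    (hb : ∀ Q : Finset (Fin n), G.IsClique (Q : Set (Fin n)) → ∑ i ∈ Q, a i ≤ b) :
    ∃ η : Finset (Fin n) → ℕ, (∀ S, η S ≠ 0 → IsIndepSet G S) ∧
      (∀ i, a i = ∑ S, η S * (if i ∈ S then 1 else 0)) ∧ b = ∑ S, η S := by
  classical
  let s : Set (Fin n) := {i | a i = 1}
  have hω : cliqueNumber (G.induce s) ≤ b := by
    refine cliqueNumber_le fun t ht => ?_
    have hQ : G.IsClique ((t.map (Function.Embedding.subtype _) : Finset (Fin n)) :
        Set (Fin n)) := by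
      intro x hx y hy hxy
      simp only [Finset.coe_map, Set.mem_image, Finset.mem_coe] at hx hy
      obtain ⟨x, hx, rfl⟩ := hx
      obtain ⟨y, hy, rfl⟩ := hy
      exact ht hx hy (fun h => hxy (by rw [h]))
    refine le_trans (le_of_eq ?_) (hb _ hQ)
    rw [Finset.sum_map, Finset.card_eq_sum_ones]
    exact Finset.sum_congr rfl fun x _ => x.2.symm
  have hcol : (G.induce s).Colorable b := by
    rw [← SimpleGraph.chromaticNumber_le_iff_colorable, hperf s]
    exact_mod_cast hω
  obtain ⟨C⟩ := hcol
  let f : Fin b → Finset (Fin n) := fun k => Finset.univ.filter fun i => ∃ h : i ∈ s, C ⟨i, h⟩ = k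
  have hsum : ∀ g : Finset (Fin n) → ℕ,
      ∑ S, (Finset.univ.filter fun k => f k = S).card * g S = ∑ k, g (f k) := by
    intro g
    rw [← Finset.sum_fiberwise Finset.univ f]
    refine Finset.sum_congr rfl fun S _ => ?_
    rw [Finset.sum_congr rfl (g := fun _ => g S) (by simp +contextual), Finset.sum_const,
      smul_eq_mul]
  refine ⟨fun S => (Finset.univ.filter fun k => f k = S).card, fun S hS => ?_, fun i => ?_, ?_⟩
  · obtain ⟨k, hk⟩ := Finset.card_ne_zero.1 hS
    rw [← (Finset.mem_filter.1 hk).2]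
    intro x hx y hy hxy
    obtain ⟨hxs, hxk⟩ := (Finset.mem_filter.1 hx).2
    obtain ⟨hys, hyk⟩ := (Finset.mem_filter.1 hy).2
    exact C.valid (v := ⟨x, hxs⟩) (w := ⟨y, hys⟩) hxy (hxk.trans hyk.symm)
  · rw [hsum fun S => if i ∈ S then 1 else 0]
    by_cases hi : i ∈ s
    · have h1 : a i = 1 := hi
      simp [f, hi, h1]
    · have h0 : a i = 0 := by
        have := ha i
        have : a i ≠ 1 := hi
        omega
      simp [f, hi, h0]
  · simpa using (hsum fun _ => 1).symm

/-- Lovász's replication lemma in weighted form: in a perfect graph, a vertex weighting under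
which every clique has weight at most `b` is a sum of incidence vectors of `b` independent sets. -/
theorem IsPerfect.exists_indep_decomposition (hperf : IsPerfect G) (a : Fin n → ℕ) (b : ℕ)
    (hb : ∀ Q : Finset (Fin n), G.IsClique (Q : Set (Fin n)) → ∑ i ∈ Q, a i ≤ b) :
    ∃ η : Finset (Fin n) → ℕ, (∀ S, η S ≠ 0 → IsIndepSet G S) ∧
      (∀ i, a i = ∑ S, η S * (if i ∈ S then 1 else 0)) ∧ b = ∑ S, η S := by
  induction hN : ∑ i, a i using Nat.strong_induction_on generalizing a b with
  | _ N ih =>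
  by_cases ha : ∀ i, a i ≤ 1
  · exact hperf.exists_indep_decomposition_of_le_one ha hb
  push Not at ha
  obtain ⟨i, hi⟩ := ha
  -- lower the weight of `i` by one and decompose
  obtain ⟨a', ha'⟩ : ∃ a' : Fin n → ℕ, ∀ j, a j = a' j + if j = i then 1 else 0 := by
    refine ⟨fun j => a j - if j = i then 1 else 0, fun j => ?_⟩
    by_cases h : j = i
    · subst h; simp; omega
    · simp [h]
  have haQ : ∀ Q : Finset (Fin n), ∑ j ∈ Q, a j = ∑ j ∈ Q, a' j + if i ∈ Q then 1 else 0 := by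
    intro Q
    simp only [ha', Finset.sum_add_distrib, Finset.sum_ite_eq']
  have hlt : ∑ j, a' j < N := by
    rw [← hN, haQ]; simp
  obtain ⟨η, hη, hηa, hηb⟩ := ih _ hlt a' b
    (fun Q hQ => le_trans (by rw [haQ]; omega) (hb Q hQ)) rfl
  -- a class `S` through `i`
  have hi' : a' i ≠ 0 := by
    have := ha' i
    simp at this
    omega
  rw [hηa i] at hi'
  obtain ⟨S, -, hS⟩ := Finset.exists_ne_zero_of_sum_ne_zero hi'
  have hηS : η S ≠ 0 := left_ne_zero_of_mul hS
  have hiS : i ∈ S := by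
    by_contra h
    simp [h] at hS
  have hle : ∀ j, (if j ∈ S.erase i then 1 else 0) ≤ a' j := by
    intro j
    by_cases hj : j ∈ S
    · have h1 : η S * (if j ∈ S then 1 else 0) ≤ a' j := by
        rw [hηa j]
        exact Finset.single_le_sum (f := fun T => η T * (if j ∈ T then 1 else 0))
          (fun _ _ => Nat.zero_le _) (Finset.mem_univ S)
      simp only [hj, if_true, mul_one] at h1
      split_ifs <;> omega
    · simp [hj]
  obtain ⟨a'', ha''⟩ : ∃ a'' : Fin n → ℕ, ∀ j, a' j = a'' j + if j ∈ S.erase i then 1 else 0 :=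
    ⟨fun j => a' j - if j ∈ S.erase i then 1 else 0, fun j => (Nat.sub_add_cancel (hle j)).symm⟩
  have haQ' : ∀ Q : Finset (Fin n), ∑ j ∈ Q, a' j = ∑ j ∈ Q, a'' j + (Q ∩ S.erase i).card := by
    intro Q
    simp only [ha'', Finset.sum_add_distrib, Finset.sum_boole, Finset.filter_mem_eq_inter,
      Nat.cast_id]
  obtain ⟨d, rfl⟩ : ∃ d, b = d + 1 := by
    have := Finset.single_le_sum (f := η) (fun _ _ => Nat.zero_le _) (Finset.mem_univ S)
    exact Nat.exists_eq_succ_of_ne_zero (by omega)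
  have hd : ∀ Q : Finset (Fin n), G.IsClique (Q : Set (Fin n)) → ∑ j ∈ Q, a'' j ≤ d := by
    intro Q hQ
    have h1 := hb Q hQ
    have h2 := haQ Q
    have h3 := haQ' Q
    by_cases hiQ : i ∈ Q
    · simp only [hiQ, if_true] at h2
      omega
    by_cases hQS : (Q ∩ S.erase i).Nonempty
    · have := hQS.card_pos
      omega
    have hQS' : (Q ∩ S).card = 0 := by
      rw [Finset.card_eq_zero, Finset.eq_empty_iff_forall_notMem]
      intro x hx
      rw [Finset.mem_inter] at hx
      refine hQS ⟨x, Finset.mem_inter.2 ⟨hx.1, Finset.mem_erase.2 ⟨?_, hx.2⟩⟩⟩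
      rintro rfl
      exact hiQ hx.1
    have h4 : ∑ j ∈ Q, a' j = ∑ T, η T * (Q ∩ T).card := by
      simpa only [← hηa, Nat.cast_id] using sum_incidence_eq η Q
    have h5 : ∑ T, η T * (Q ∩ T).card < ∑ T, η T := by
      refine Finset.sum_lt_sum (fun T _ => ?_) ⟨S, Finset.mem_univ S, ?_⟩
      · by_cases hT : η T = 0
        · simp [hT]
        · exact mul_le_of_le_one_right' ((hη T hT).card_inter_clique_le_one hQ)
      · rw [hQS']; omega
    omega
  have hlt' : ∑ j, a'' j < N := by
    have := haQ' Finset.univ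
    omega
  obtain ⟨θ, hθ, hθa, hθb⟩ := ih _ hlt' a'' d hd rfl
  refine ⟨fun T => θ T + if T = S then 1 else 0, fun T hT => ?_, fun j => ?_, ?_⟩
  · by_cases h : T = S
    · exact h ▸ hη S hηS
    · exact hθ T (by simpa [h] using hT)
  · simp only [add_mul, Finset.sum_add_distrib, ← hθa, ite_mul, one_mul, zero_mul,
      Finset.sum_ite_eq', Finset.mem_univ, if_true]
    rw [ha' j, ha'' j]
    by_cases hj : j = i
    · subst hj; simp [hiS]
    · simp [hj]
  · simp [Finset.sum_add_distrib, ← hθb]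

/-- In an unmixed graph, if the classes of a combination of independent sets have the same total
size as for `b` maximal independent sets, they are all maximal. -/
theorem Unmixed.isMaxIndepSet_of_sum_card_eq (hunm : Unmixed G) {η : Finset (Fin n) → ℕ}
    (hη : ∀ S, η S ≠ 0 → IsIndepSet G S) {S₀ : Finset (Fin n)} (hS₀ : IsMaxIndepSet G S₀)
    (hsum : ∑ S, η S * S.card = (∑ S, η S) * S₀.card) (S : Finset (Fin n)) (hS : η S ≠ 0) :
    IsMaxIndepSet G S := by
  have hcard : ∀ T, η T ≠ 0 → T.card ≤ S₀.card := by
    intro T hT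
    obtain ⟨U, hU, hTU⟩ := (hη T hT).exists_maxIndepSet_superset
    exact (Finset.card_le_card hTU).trans (hunm.card_eq hU hS₀).le
  have hle : ∀ T ∈ Finset.univ, η T * T.card ≤ η T * S₀.card := by
    intro T _
    by_cases hT : η T = 0
    · simp [hT]
    · exact Nat.mul_le_mul_left _ (hcard T hT)
  rw [Finset.sum_mul, Finset.sum_eq_sum_iff_of_le hle] at hsum
  have hEq := Nat.eq_of_mul_eq_mul_left (Nat.pos_of_ne_zero hS) (hsum S (Finset.mem_univ S))
  obtain ⟨U, hU, hSU⟩ := (hη S hS).exists_maxIndepSet_superset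
  rwa [Finset.eq_of_subset_of_card_le hSU (by rw [hEq, hunm.card_eq hU hS₀])]

end

/-- If `G` is a perfect unmixed graph with no isolated
vertices and `v_1,…,v_q` are the incidence vectors of the maximal independent
sets of `G`, then `K[x^{v_1}t,…,x^{v_q}t]` is normal: every vector of
`ℤ^{n+1}` that lies in the cone of non-negative real combinations of the
`(v_i,1)` and in the subgroup of `ℤ^{n+1}` generated by the `(v_i,1)` is a
non-negative integer combination of the `(v_i,1)`. -/
theorem maxIndep_subring_normal {n : ℕ} (G : SimpleGraph (Fin n))
    (hiso : ∀ v : Fin n, ∃ w : Fin n, G.Adj v w)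
    (hperf : IsPerfect G) (hunm : Unmixed G) :
    ∀ z : (Fin n → ℤ) × ℤ,
      (∃ c : Finset (Fin n) → ℝ, (∀ S, 0 ≤ c S) ∧
        (∀ S, c S ≠ 0 → IsMaxIndepSet G S) ∧
        (∀ i, (z.1 i : ℝ) = ∑ S : Finset (Fin n), c S * (if i ∈ S then 1 else 0)) ∧
        (z.2 : ℝ) = ∑ S : Finset (Fin n), c S) →
      (∃ c : Finset (Fin n) → ℤ, (∀ S, c S ≠ 0 → IsMaxIndepSet G S) ∧
        (∀ i, z.1 i = ∑ S : Finset (Fin n), c S * (if i ∈ S then 1 else 0)) ∧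
        z.2 = ∑ S : Finset (Fin n), c S) →
      ∃ η : Finset (Fin n) → ℕ, (∀ S, η S ≠ 0 → IsMaxIndepSet G S) ∧
        (∀ i, z.1 i = ∑ S : Finset (Fin n), (η S : ℤ) * (if i ∈ S then 1 else 0)) ∧
        z.2 = ∑ S : Finset (Fin n), (η S : ℤ) := by
  rintro ⟨z, m⟩ ⟨c, hc0, hcS, hcz, hcm⟩ -
  simp only at hcz hcm ⊢
  have hz0 : ∀ i, 0 ≤ z i := by
    intro i
    have : (0 : ℝ) ≤ z i := by
      rw [hcz i]
      exact Finset.sum_nonneg fun S _ => mul_nonneg (hc0 S) (by split_ifs <;> norm_num)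
    exact_mod_cast this
  have hm0 : 0 ≤ m := by
    have : (0 : ℝ) ≤ m := hcm ▸ Finset.sum_nonneg fun S _ => hc0 S
    exact_mod_cast this
  lift z to Fin n → ℕ using hz0
  lift m to ℕ using hm0
  simp only [Int.cast_natCast] at hcz hcm
  have hzQ : ∀ Q : Finset (Fin n), ((∑ i ∈ Q, z i : ℕ) : ℝ) = ∑ S, c S * ((Q ∩ S).card : ℝ) := by
    intro Q
    rw [← sum_incidence_eq, Nat.cast_sum]
    exact Finset.sum_congr rfl fun i _ => hcz i
  obtain ⟨η, hη, hηz, hηm⟩ := hperf.exists_indep_decomposition z m fun Q hQ => by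
    have h : ((∑ i ∈ Q, z i : ℕ) : ℝ) ≤ m := by
      rw [hzQ, hcm]
      refine Finset.sum_le_sum fun S _ => ?_
      by_cases hS : c S = 0
      · simp [hS]
      · exact mul_le_of_le_one_right (hc0 S)
          (by exact_mod_cast (hcS S hS).1.card_inter_clique_le_one hQ)
    exact_mod_cast h
  obtain ⟨S₀, hS₀, -⟩ := IsIndepSet.exists_maxIndepSet_superset (G := G) (S := ∅)
    (fun _ h => absurd h (Finset.notMem_empty _))
  have hsum : ∑ S, η S * S.card = (∑ S, η S) * S₀.card := by
    have h1 : ∑ S, η S * S.card = ∑ i, z i := by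
      simpa only [← hηz, Nat.cast_id, Finset.univ_inter] using
        (sum_incidence_eq η Finset.univ).symm
    have h2 : ((∑ i, z i : ℕ) : ℝ) = (m * S₀.card : ℕ) := by
      rw [hzQ, Nat.cast_mul, hcm, Finset.sum_mul]
      refine Finset.sum_congr rfl fun S _ => ?_
      by_cases hS : c S = 0
      · simp [hS]
      · rw [Finset.univ_inter, hunm.card_eq (hcS S hS) hS₀]
    rw [h1, ← hηm]
    exact_mod_cast h2
  refine ⟨η, hunm.isMaxIndepSet_of_sum_card_eq hη hS₀ hsum, fun i => ?_, ?_⟩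
  · change (z i : ℤ) = _
    rw [hηz i]
    push_cast
    rfl
  · exact_mod_cast hηm
end

section
/- If G is a perfect finite simple graph on vertices x_1,…,x_n with no isolated vertices, then the Rees algebra R[I_c(G)t] of the ideal of vertex covers of G is normal; equivalently, letting u_1,…,u_s ∈ {0,1}^n be the incidence vectors of the minimal vertex covers of G, the set A' = { e_1,…,e_n, (u_1,1),…,(u_s,1) } is an integral Hilbert basis, i.e., ℕA' = ℤ^{n+1} ∩ ℝ₊(I_c(G)). -/
open Finset

/-- `z ∈ ℕA'`: the integral vector `z ∈ ℤ^{n+1}` is a non-negative integer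
combination of `A' = {e_1,…,e_n, (u_1,1),…,(u_s,1)}`, where `u_1,…,u_s` are
the incidence vectors of the minimal vertex covers of `G`. -/
def IsNNCombA' {n : ℕ} (G : SimpleGraph (Fin n)) (z : (Fin n → ℤ) × ℤ) : Prop :=
  ∃ (c : Fin n → ℕ) (d : Finset (Fin n) → ℕ),
    (∀ C, d C ≠ 0 → IsMinVCover G C) ∧
    (∀ i, z.1 i = (c i : ℤ) + ∑ C : Finset (Fin n), (d C : ℤ) * (if i ∈ C then 1 else 0)) ∧
    z.2 = ∑ C : Finset (Fin n), (d C : ℤ)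

/-- A clique meets an independent set in at most one vertex. -/
theorem SimpleGraph.IsClique.sum_ite_mem_le_one {V : Type*} [DecidableEq V] {G : SimpleGraph V}
    {K S : Finset V} (hK : G.IsClique (K : Set V)) (hS : G.IsIndepSet (S : Set V)) :
    ∑ i ∈ K, (if i ∈ S then 1 else 0) ≤ 1 := by
  rw [Finset.sum_boole, Nat.cast_id, Finset.card_le_one]
  intro a ha b hb
  simp only [Finset.mem_filter] at ha hb
  by_contra hab
  exact hS ha.2 hb.2 hab (hK ha.1 hb.1 hab)

/-- A perfect graph whose cliques inside `s` have at most `b` vertices has `b` independent sets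
covering `s`. -/
theorem IsPerfect.exists_indepSet_cover {V : Type*} [Fintype V] [DecidableEq V]
    {G : SimpleGraph V} (hG : IsPerfect G) (s : Set V) (b : ℕ)
    (hb : ∀ K : Finset V, G.IsClique (K : Set V) → (K : Set V) ⊆ s → K.card ≤ b) :
    ∃ f : Fin b → Finset V, (∀ j, G.IsIndepSet (f j : Set V)) ∧ ∀ i ∈ s, ∃ j, i ∈ f j := by
  classical
  have hω : cliqueNumber (G.induce s) ≤ b := by
    refine csSup_le' ?_
    rintro k ⟨t, ht⟩
    rw [← ht.card_eq, ← Finset.card_map (Function.Embedding.subtype (· ∈ s))]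
    refine hb _ ?_ ?_
    · intro x hx y hy hxy
      simp only [Finset.coe_map, Set.mem_image, Finset.mem_coe] at hx hy
      obtain ⟨x', hx', rfl⟩ := hx
      obtain ⟨y', hy', rfl⟩ := hy
      exact ht.isClique hx' hy' (fun h => hxy (by rw [h]))
    · intro x hx
      simp only [Finset.coe_map, Set.mem_image, Finset.mem_coe] at hx
      obtain ⟨x', -, rfl⟩ := hx
      exact x'.2
  have hcol : (G.induce s).Colorable b := by
    rw [← SimpleGraph.chromaticNumber_le_iff_colorable, hG s]
    exact_mod_cast hω
  obtain ⟨col⟩ := hcol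
  refine ⟨fun j => Finset.univ.filter fun i => ∃ h : i ∈ s, col ⟨i, h⟩ = j, ?_, ?_⟩
  · intro j x hx y hy _ hadj
    simp only [Finset.coe_filter, Finset.mem_univ, true_and, Set.mem_ofPred_eq] at hx hy
    obtain ⟨hxs, hx⟩ := hx
    obtain ⟨hys, hy⟩ := hy
    exact col.valid (v := ⟨x, hxs⟩) (w := ⟨y, hys⟩) hadj (hx.trans hy.symm)
  · intro i hi
    exact ⟨col ⟨i, hi⟩, by simp [hi]⟩

/-- Weighted form of Lovász's replication lemma: in a perfect graph, if every clique has weight at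
most `b`, then some `b` independent sets cover each vertex at least as often as its weight. -/
theorem IsPerfect.exists_weighted_indepSet_cover {V : Type*} [Fintype V] [DecidableEq V]
    {G : SimpleGraph V} (hG : IsPerfect G) (w : V → ℕ) (b : ℕ)
    (hb : ∀ K : Finset V, G.IsClique (K : Set V) → ∑ i ∈ K, w i ≤ b) :
    ∃ f : Fin b → Finset V, (∀ j, G.IsIndepSet (f j : Set V)) ∧
      ∀ i, w i ≤ ∑ j, if i ∈ f j then 1 else 0 := by
  induction hm : ∑ i, w i using Nat.strong_induction_on generalizing w b with
  | _ m ih =>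
  subst hm
  by_cases hw : ∀ i, w i ≤ 1
  · obtain ⟨f, hf, hcov⟩ := hG.exists_indepSet_cover {i | 0 < w i} b (fun K hK hKs => by
      refine le_trans ?_ (hb K hK)
      rw [Finset.card_eq_sum_ones]
      exact Finset.sum_le_sum fun i hi => hKs hi)
    refine ⟨f, hf, fun i => ?_⟩
    rcases Nat.eq_zero_or_pos (w i) with h0 | h0
    · omega
    · obtain ⟨j, hj⟩ := hcov i h0
      refine (hw i).trans ?_
      have := Finset.single_le_sum (f := fun j => if i ∈ f j then 1 else 0)
        (fun j _ => Nat.zero_le _) (Finset.mem_univ j)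
      simpa [hj] using this
  push Not at hw
  obtain ⟨v, hv⟩ := hw
  have hb1 : w v ≤ b := by simpa using hb {v} (by simp)
  obtain ⟨b, rfl⟩ : ∃ b', b = b' + 1 := ⟨b - 1, by omega⟩
  have hlt : ∑ i, Function.update w v (w v - 1) i < ∑ i, w i := by
    refine Finset.sum_lt_sum (fun i _ => ?_) ⟨v, Finset.mem_univ v, ?_⟩
    · by_cases h : i = v
      · subst h; simp
      · simp [h]
    · simp only [Function.update_self]; omega
  obtain ⟨f, hf, hcov⟩ := ih _ hlt (Function.update w v (w v - 1)) (b + 1) (fun K hK =>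
    (Finset.sum_le_sum fun i _ => by
      by_cases h : i = v
      · subst h; simp
      · simp [h]).trans (hb K hK)) rfl
  obtain ⟨j₀, hj₀⟩ : ∃ j, v ∈ f j := by
    by_contra! h
    have := hcov v
    simp [h] at this
    omega
  have hlt' : ∑ i, (w i - if i ∈ f j₀ then 1 else 0) < ∑ i, w i := by
    refine Finset.sum_lt_sum (fun i _ => Nat.sub_le _ _) ⟨v, Finset.mem_univ v, ?_⟩
    simp only [hj₀, if_true]; omega
  have hclique : ∀ K : Finset V, G.IsClique (K : Set V) →
      ∑ i ∈ K, (w i - if i ∈ f j₀ then 1 else 0) ≤ b := by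
    intro K hK
    by_contra! hlarge
    -- Discard the vertices of weight zero: the remaining clique meets every `f j`.
    set L := K.filter fun i => 0 < w i with hL
    have hLc : G.IsClique (L : Set V) := hK.subset (Finset.coe_subset.2 (Finset.filter_subset _ _))
    have hLsum : ∑ i ∈ L, (w i - if i ∈ f j₀ then 1 else 0) =
        ∑ i ∈ K, (w i - if i ∈ f j₀ then 1 else 0) :=
      Finset.sum_subset (Finset.filter_subset _ _) fun i hi hiL => by
        simp only [hL, Finset.mem_filter, hi, true_and] at hiL
        omega
    have hdisj : ∀ i ∈ L, i ∉ f j₀ := by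
      intro i hi hif
      have hlt : ∑ i ∈ L, (w i - if i ∈ f j₀ then 1 else 0) < ∑ i ∈ L, w i := by
        refine Finset.sum_lt_sum (fun i _ => Nat.sub_le _ _) ⟨i, hi, ?_⟩
        simp only [hL, Finset.mem_filter] at hi
        simp only [hif, if_true]; omega
      have := hb L hLc
      omega
    have hcount : ∑ i ∈ L, w i ≤ ∑ j, ∑ i ∈ L, (if i ∈ f j then 1 else 0) := by
      rw [Finset.sum_comm]
      refine Finset.sum_le_sum fun i hi => ?_
      have hiv : i ≠ v := fun h => hdisj i hi (h ▸ hj₀)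
      simpa [hiv] using hcov i
    have hstrict : ∑ j, ∑ i ∈ L, (if i ∈ f j then 1 else 0) < ∑ _j : Fin (b + 1), 1 := by
      refine Finset.sum_lt_sum (fun j _ => hLc.sum_ite_mem_le_one (hf j))
        ⟨j₀, Finset.mem_univ _, ?_⟩
      rw [Finset.sum_eq_zero fun i hi => if_neg (hdisj i hi)]
      exact one_pos
    have hle : ∑ i ∈ L, (w i - if i ∈ f j₀ then 1 else 0) ≤ ∑ i ∈ L, w i :=
      Finset.sum_le_sum fun i _ => Nat.sub_le _ _
    simp only [Finset.sum_const, Finset.card_univ, Fintype.card_fin, smul_eq_mul, mul_one]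
      at hstrict
    omega
  obtain ⟨g, hg, hgcov⟩ := ih _ hlt' (fun i => w i - if i ∈ f j₀ then 1 else 0) b
    hclique rfl
  refine ⟨Fin.cons (f j₀) g, fun j => ?_, fun i => ?_⟩
  · refine Fin.cases ?_ (fun j => ?_) j
    · simpa using hf j₀
    · simpa using hg j
  · have := hgcov i
    simp only [Fin.sum_univ_succ, Fin.cons_zero, Fin.cons_succ]
    omega

/-- Every vertex cover contains a minimal one. -/
theorem IsVCover.exists_isMinVCover_subset {n : ℕ} {G : SimpleGraph (Fin n)}
    {C : Finset (Fin n)} (hC : IsVCover G C) : ∃ D ⊆ C, IsMinVCover G D := by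
  induction C using Finset.strongInduction with
  | H C ih =>
  by_cases h : ∃ D, D ⊂ C ∧ IsVCover G D
  · obtain ⟨D, hDC, hD⟩ := h
    obtain ⟨E, hED, hE⟩ := ih D hDC hD
    exact ⟨E, hED.trans hDC.subset, hE⟩
  · push Not at h
    exact ⟨C, subset_rfl, hC, h⟩

/-- A vertex cover misses at most one vertex of a clique. -/
theorem IsVCover.card_le_sum_ite_mem_add_one {n : ℕ} {G : SimpleGraph (Fin n)}
    {C K : Finset (Fin n)} (hC : IsVCover G C) (hK : G.IsClique (K : Set (Fin n))) :
    K.card ≤ (∑ i ∈ K, if i ∈ C then 1 else 0) + 1 := by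
  have hind : G.IsIndepSet ((Cᶜ : Finset (Fin n)) : Set (Fin n)) := by
    intro x hx y hy _ hadj
    rcases hC hadj with h | h <;> simp_all
  have hsplit : K.card = ∑ i ∈ K, ((if i ∈ C then 1 else 0) + if i ∈ Cᶜ then 1 else 0) := by
    rw [Finset.card_eq_sum_ones]
    exact Finset.sum_congr rfl fun i _ => by by_cases h : i ∈ C <;> simp [h]
  rw [hsplit, Finset.sum_add_distrib]
  exact Nat.add_le_add_left (hK.sum_ite_mem_le_one hind) _

/-- The clique inequalities are valid on the Rees cone. -/
theorem reesCone_clique_le {n : ℕ} {G : SimpleGraph (Fin n)} {v : (Fin n → ℝ) × ℝ}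
    (hv : v ∈ reesCone G) {K : Finset (Fin n)} (hK : G.IsClique (K : Set (Fin n))) :
    K.card * v.2 ≤ ∑ i ∈ K, v.1 i + v.2 := by
  obtain ⟨c, d, hc, hd, hmin, h1, h2⟩ := hv
  have hcov : ∑ C, d C * (K.card : ℝ) ≤
      ∑ C, d C * ((∑ i ∈ K, if i ∈ C then (1 : ℝ) else 0) + 1) := by
    refine Finset.sum_le_sum fun C _ => ?_
    by_cases h0 : d C = 0
    · simp [h0]
    · refine mul_le_mul_of_nonneg_left ?_ (hd C)
      exact_mod_cast (hmin C h0).1.card_le_sum_ite_mem_add_one hK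
  have hcK : 0 ≤ ∑ i ∈ K, c i := Finset.sum_nonneg fun i _ => hc i
  have hswap : ∑ C, d C * (∑ i ∈ K, if i ∈ C then (1 : ℝ) else 0) =
      ∑ i ∈ K, ∑ C, d C * (if i ∈ C then 1 else 0) := by
    rw [Finset.sum_comm]
    exact Finset.sum_congr rfl fun C _ => Finset.mul_sum _ _ _
  simp only [mul_add, mul_one, Finset.sum_add_distrib, ← Finset.sum_mul, hswap, ← h2] at hcov
  simp only [h1, Finset.sum_add_distrib]
  linarith

/-- If `G` is a perfect graph with no isolated vertices, then
the Rees algebra `R[I_c(G)t]` is normal; equivalently,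
`A' = {e_1,…,e_n,(u_1,1),…,(u_s,1)}` (where `u_1,…,u_s` are the incidence
vectors of the minimal vertex covers of `G`) is an integral Hilbert basis:
`ℕA' = ℤ^{n+1} ∩ ℝ₊(I_c(G))`. -/
theorem rees_vertexCovers_normal_of_perfect {n : ℕ} (G : SimpleGraph (Fin n))
    (hiso : ∀ v : Fin n, ∃ w : Fin n, G.Adj v w)
    (hperf : IsPerfect G) :
    ∀ z : (Fin n → ℤ) × ℤ,
      ((fun i => (z.1 i : ℝ)), (z.2 : ℝ)) ∈ reesCone G ↔ IsNNCombA' G z := by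
  intro z
  constructor
  · intro hz
    have hz2 : 0 ≤ z.2 := by
      have := reesCone_clique_le hz (K := ∅) (by simp)
      simpa using this
    obtain ⟨b, hb⟩ := Int.eq_ofNat_of_zero_le hz2
    have hclique : ∀ K : Finset (Fin n), G.IsClique (K : Set (Fin n)) →
        K.card * (b : ℤ) ≤ ∑ i ∈ K, z.1 i + b := by
      intro K hK
      have := reesCone_clique_le hz hK
      rw [hb] at this
      dsimp only at this
      exact_mod_cast this
    have hnonneg : ∀ i, 0 ≤ z.1 i := by
      intro i
      have := hclique {i} (by simp)
      simp only [Finset.card_singleton, Finset.sum_singleton] at this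
      omega
    obtain ⟨f, hf, hcov⟩ := hperf.exists_weighted_indepSet_cover
      (fun i => ((b : ℤ) - z.1 i).toNat) b (fun K hK => by
        have hL := hclique (K.filter fun i => z.1 i ≤ b)
          (hK.subset (Finset.coe_subset.2 (Finset.filter_subset _ _)))
        have heq : (∑ i ∈ K, (((b : ℤ) - z.1 i).toNat : ℤ)) =
            ∑ i ∈ K.filter (fun i => z.1 i ≤ b), ((b : ℤ) - z.1 i) := by
          rw [Finset.sum_filter]
          refine Finset.sum_congr rfl fun i _ => ?_
          split_ifs <;> omega
        rw [Finset.sum_sub_distrib, Finset.sum_const, nsmul_eq_mul] at heq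
        zify
        omega)
    have hcompl : ∀ j, ∃ D ⊆ (f j)ᶜ, IsMinVCover G D := fun j =>
      IsVCover.exists_isMinVCover_subset fun x y hxy => by
        by_contra! h
        simp only [Finset.mem_compl, not_not] at h
        exact hf j h.1 h.2 hxy.ne hxy
    choose D hDf hDmin using hcompl
    have hcount : ∀ φ : Finset (Fin n) → ℤ,
        ∑ C, ((∑ j, if D j = C then 1 else 0 : ℕ) : ℤ) * φ C = ∑ j, φ (D j) := by
      intro φ
      push_cast
      simp only [Finset.sum_mul]
      rw [Finset.sum_comm]
      simp
    have hle : ∀ i, ∑ j, (if i ∈ D j then (1 : ℤ) else 0) ≤ z.1 i := by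
      intro i
      have hi := hcov i
      have hsum : ∑ j, (if i ∈ D j then 1 else 0) + ∑ j, (if i ∈ f j then 1 else 0) ≤ b := by
        rw [← Finset.sum_add_distrib]
        calc _ ≤ ∑ _j : Fin b, 1 := Finset.sum_le_sum fun j _ => by
              by_cases h : i ∈ D j
              · have := hDf j h
                simp_all
              · simp only [h, if_false, zero_add]
                split_ifs <;> simp
          _ = b := by simp
      zify at hsum hi
      have := hnonneg i
      omega
    refine ⟨fun i => (z.1 i - ∑ j, if i ∈ D j then (1 : ℤ) else 0).toNat,
      fun C => ∑ j, if D j = C then 1 else 0, fun C hC => ?_, fun i => ?_, ?_⟩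
    · obtain ⟨j, -, hj⟩ := Finset.exists_ne_zero_of_sum_ne_zero hC
      have : D j = C := by
        by_contra h
        simp [h] at hj
      exact this ▸ hDmin j
    · rw [hcount fun C => if i ∈ C then 1 else 0, Int.toNat_of_nonneg (sub_nonneg.2 (hle i))]
      ring
    · have := hcount fun _ => 1
      simp only [mul_one] at this
      rw [this, hb]
      simp
  · rintro ⟨c, d, hmin, h1, h2⟩
    refine ⟨fun i => c i, fun C => d C, fun i => by positivity, fun C => by positivity,
      fun C hC => hmin C (Nat.cast_ne_zero.1 hC), fun i => ?_, ?_⟩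
    · simp only [h1 i]
      push_cast
      rfl
    · simp only [h2]
      push_cast
      rfl
end
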